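/- Let X be a nontrivial finite group with k := k(X) conjugacy classes. Let t ≥ 1, m ≥ 5, 1 ≤ ℓ < m/2 with (t,ℓ) ≠ (1,1), and let Ω be the set of ℓ-element subsets of {1,…,m}. Let H be a large base primitive permutation group of degree n = C(m,ℓ)^t, i.e., (Alt(m))^t ≤ H ≤ Sym(m) ≀ Sym(t) where Sym(m) acts on Ω and the wreath product acts on Ω^t via the product action. Let G = X ≀ H. Then there exists an absolute constant C such that whenever n ≥ C or k ≥ C, one has k(G) ≤ k^n. -/

import Mathlib

open Equiv MulAction

/-- The number of conjugacy classes of a group. -/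
noncomputable def kclass (G : Type*) [Group G] : ℕ := Nat.card (ConjClasses G)

/-- The coordinate-permuting action of `Perm ι` on `ι → X`, as automorphisms. -/
def permAut (ι X : Type*) [Group X] : Perm ι →* MulAut (ι → X) where
  toFun e :=
    { toFun := fun f => f ∘ e.symm
      invFun := fun f => f ∘ e
      left_inv := fun f => by funext i; simp
      right_inv := fun f => by funext i; simp
      map_mul' := fun f g => rfl }
  map_one' := by ext f; rfl
  map_mul' := fun e₁ e₂ => by ext f; rfl

/-- The wreath product `X ≀ H` of a group `X` with a permutation group `H ≤ Perm ι`,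
i.e. the semidirect product `X^ι ⋊ H` where `H` permutes the direct factors of `X^ι`. -/
abbrev Wreath (X : Type*) [Group X] {ι : Type*} (H : Subgroup (Perm ι)) :=
  SemidirectProduct (ι → X) H ((permAut ι X).comp H.subtype)

/-- A group acting on `Ω` acts on the functions `Ω → S` by permuting coordinates. -/
instance funMulAction (G Ω S : Type*) [Group G] [MulAction G Ω] : MulAction G (Ω → S) where
  smul g f := fun ω => f (g⁻¹ • ω)
  one_smul f := funext fun ω => by
    show f ((1 : G)⁻¹ • ω) = f ω
    rw [inv_one, one_smul]
  mul_smul g h f := funext fun ω => by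
    show f ((g * h)⁻¹ • ω) = f (h⁻¹ • g⁻¹ • ω)
    rw [mul_inv_rev, mul_smul]

/-- `σ(h)`: the number of cycles of a permutation `h` in its disjoint cycle decomposition,
with fixed points counted as cycles of length 1; equivalently, the number of orbits of
the cyclic group generated by `h`. -/
noncomputable def cycleCount {ι : Type*} (h : Perm ι) : ℕ :=
  Nat.card (orbitRel.Quotient (Subgroup.zpowers h) ι)

/-- `n(G, α)`: the number of orbits of a group action. -/
noncomputable def orbitCount (G : Type*) [Group G] (α : Type*) [MulAction G α] : ℕ :=
  Nat.card (orbitRel.Quotient G α)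

/-- The natural action of `Perm (Fin m)` on the set of `ℓ`-element subsets of `{1, …, m}`. -/
instance subsetsMulAction (m ℓ : ℕ) :
    MulAction (Perm (Fin m)) {s : Finset (Fin m) // s.card = ℓ} where
  smul g s := ⟨s.1.image g, by rw [Finset.card_image_of_injective _ g.injective, s.2]⟩
  one_smul s := Subtype.ext (by
    show Finset.image ⇑(1 : Perm (Fin m)) s.1 = s.1
    simp)
  mul_smul g h s := Subtype.ext (by
    show Finset.image ⇑(g * h) s.1 = Finset.image ⇑g (Finset.image ⇑h s.1)
    simp [Finset.image_image, Function.comp_def])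

/-- The set of `ℓ`-element subsets of `{1, …, m}`. -/
abbrev Omega (m ℓ : ℕ) := {s : Finset (Fin m) // s.card = ℓ}

/-- The homomorphism `Sym(m) → Sym(Ω)` induced by the action on `ℓ`-subsets. -/
def subsetsHom (m ℓ : ℕ) : Perm (Fin m) →* Perm (Omega m ℓ) :=
  MulAction.toPermHom _ _

/-- The base of a wreath product in product action: `(Sym Ω)^t → Sym (Ω^t)`. -/
def baseHom (t : ℕ) (Ω : Type*) : (Fin t → Perm Ω) →* Perm (Fin t → Ω) :=
  MulAction.toPermHom _ _

/-- The top of a wreath product in product action: `Sym(t) → Sym (Ω^t)`,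
permuting coordinates. -/
def topHom (t : ℕ) (Ω : Type*) : Perm (Fin t) →* Perm (Fin t → Ω) :=
  MulAction.toPermHom _ _

/-- The subgroup `(Alt m)^t` of `Sym (Ω^t)`, where `Alt m` acts on `ℓ`-subsets. -/
def largeBaseBot (m ℓ t : ℕ) : Subgroup (Perm (Fin t → Omega m ℓ)) :=
  Subgroup.map (baseHom t (Omega m ℓ))
    (Subgroup.pi Set.univ fun _ => Subgroup.map (subsetsHom m ℓ) (alternatingGroup (Fin m)))

/-- The subgroup `Sym m ≀ Sym t` of `Sym (Ω^t)` in product action,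
where `Sym m` acts on `ℓ`-subsets. -/
def largeBaseTop (m ℓ t : ℕ) : Subgroup (Perm (Fin t → Omega m ℓ)) :=
  Subgroup.map (baseHom t (Omega m ℓ)) (Subgroup.pi Set.univ fun _ => (subsetsHom m ℓ).range)
    ⊔ (topHom t (Omega m ℓ)).range


section Counting

open Classical in
/-- Number of `x` conjugating `a` to `b`. -/
noncomputable def transp {X : Type*} [Group X] [Fintype X] (a b : X) : ℕ :=
  (Finset.univ.filter fun x : X => a * x = x * b).card

lemma transp_congr {X : Type*} [Group X] [Fintype X] {a a' : X} (h : IsConj a a') (b : X) :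
    transp a b = transp a' b := by
  classical
  obtain ⟨u, hu⟩ := isConj_iff.1 h
  unfold transp
  refine Finset.card_bij (fun x _ => u * x) ?_ ?_ ?_
  · intro x hx
    simp only [Finset.mem_filter, Finset.mem_univ, true_and] at hx ⊢
    rw [← hu]
    simp only [mul_assoc, inv_mul_cancel_left, hx]
  · intro x _ y _ hxy
    exact mul_left_cancel hxy
  · intro y hy
    simp only [Finset.mem_filter, Finset.mem_univ, true_and] at hy
    refine ⟨u⁻¹ * y, ?_, by simp⟩
    simp only [Finset.mem_filter, Finset.mem_univ, true_and]
    rw [← hu] at hy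
    rw [mul_assoc u⁻¹, ← hy]
    simp [mul_assoc]

lemma transp_eq_zero {X : Type*} [Group X] [Fintype X] {a b : X}
    (h : ConjClasses.mk a ≠ ConjClasses.mk b) : transp a b = 0 := by
  classical
  unfold transp
  rw [Finset.card_eq_zero, Finset.filter_eq_empty_iff]
  intro x _ hx
  apply h
  rw [ConjClasses.mk_eq_mk_iff_isConj, isConj_iff]
  refine ⟨x⁻¹, ?_⟩
  simp [mul_assoc, hx]

/-- weight -/
noncomputable def wt {X : Type*} [Group X] [Fintype X] (a : X) : ℕ :=
  transp (Quotient.out (ConjClasses.mk a) : X) a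

lemma mk_out' {X : Type*} [Group X] (κ : ConjClasses X) :
    ConjClasses.mk (Quotient.out κ : X) = κ := Quotient.out_eq κ

lemma transp_eq_wt {X : Type*} [Group X] [Fintype X] {a b : X}
    (h : ConjClasses.mk a = ConjClasses.mk b) : transp a b = wt b := by
  unfold wt
  apply transp_congr
  rw [← ConjClasses.mk_eq_mk_iff_isConj, mk_out', h]

open Classical in
lemma sum_wt {X : Type*} [Group X] [Fintype X] (κ : ConjClasses X) :
    ∑ a ∈ Finset.univ.filter (fun a : X => ConjClasses.mk a = κ), wt a = Fintype.card X := by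
  have h1 : ∀ a ∈ Finset.univ.filter (fun a : X => ConjClasses.mk a = κ),
      wt a = (Finset.univ.filter fun x : X => x⁻¹ * Quotient.out κ * x = a).card := by
    intro a ha
    simp only [Finset.mem_filter, Finset.mem_univ, true_and] at ha
    unfold wt transp
    rw [ha]
    congr 1
    ext x
    simp only [Finset.mem_filter, Finset.mem_univ, true_and]
    rw [mul_assoc, inv_mul_eq_iff_eq_mul]
  rw [Finset.sum_congr rfl h1, ← Finset.card_univ]
  refine (Finset.card_eq_sum_card_fiberwise ?_).symm
  intro x _
  simp only [Finset.coe_filter, Finset.mem_univ, true_and, Set.mem_ofPred_eq]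
  conv_rhs => rw [← mk_out' κ]
  rw [ConjClasses.mk_eq_mk_iff_isConj, isConj_iff]
  exact ⟨x, by group⟩

/-- number of `g`-invariant colourings by classes -/
noncomputable def Fct (X : Type*) [Group X] {ι : Type*} (g : Equiv.Perm ι) : ℕ :=
  Nat.card {f : ι → ConjClasses X // ∀ i, f (g i) = f i}

open Classical in
lemma count_pairs {X : Type*} [Group X] [Fintype X] {ι : Type*} [Fintype ι] (g : Equiv.Perm ι) :
    (Finset.univ.filter fun p : (ι → X) × (ι → X) =>
      ∀ i, p.2 i * p.1 i = p.1 i * p.2 (g.symm i)).card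
      = Fintype.card X ^ Fintype.card ι * Fct X g := by
  have hfib : (Finset.univ.filter fun p : (ι → X) × (ι → X) =>
      ∀ i, p.2 i * p.1 i = p.1 i * p.2 (g.symm i)).card
      = ∑ y : ι → X, ∏ i, transp (y i) (y (g.symm i)) := by
    rw [Finset.card_eq_sum_card_fiberwise (f := Prod.snd) (t := Finset.univ) (by simp [Set.MapsTo])]
    refine Finset.sum_congr rfl fun y _ => ?_
    unfold transp
    rw [← Fintype.card_piFinset]
    refine Finset.card_bij (fun p _ => p.1) ?_ ?_ ?_
    · rintro ⟨x, y'⟩ h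
      simp only [Finset.mem_filter, Finset.mem_univ, true_and] at h
      obtain ⟨h, rfl⟩ := h
      simpa [Fintype.mem_piFinset] using h
    · rintro ⟨x, y'⟩ h ⟨x2, y2⟩ h2 h3
      simp only [Finset.mem_filter, Finset.mem_univ, true_and] at h h2 h3
      obtain ⟨h, rfl⟩ := h
      obtain ⟨h2, rfl⟩ := h2
      rw [h3]
    · intro x hx
      simp [Fintype.mem_piFinset] at hx
      exact ⟨(x, y), by simpa using hx, rfl⟩
  rw [hfib]
  have hterm : ∀ y : ι → X, ∏ i, transp (y i) (y (g.symm i)) =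
      if (∀ i, ConjClasses.mk (y (g i)) = ConjClasses.mk (y i)) then ∏ i, wt (y i) else 0 := by
    intro y
    split_ifs with h
    · rw [← Equiv.prod_comp g.symm (fun i => wt (y i))]
      refine Finset.prod_congr rfl fun i _ => transp_eq_wt ?_
      have := h (g.symm i)
      simpa using this
    · push Not at h
      obtain ⟨i, hi⟩ := h
      refine Finset.prod_eq_zero (Finset.mem_univ (g i)) ?_
      apply transp_eq_zero
      simpa using hi
  rw [Finset.sum_congr rfl fun y _ => hterm y, ← Finset.sum_filter]
  rw [← Finset.sum_fiberwise_of_maps_to (s := Finset.univ.filter fun y : ι → X =>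
      ∀ i, ConjClasses.mk (y (g i)) = ConjClasses.mk (y i))
      (t := Finset.univ.filter fun f : ι → ConjClasses X => ∀ i, f (g i) = f i)
      (g := fun y i => ConjClasses.mk (y i)) (by intro y; simp)]
  have hin : ∀ f ∈ (Finset.univ.filter fun f : ι → ConjClasses X => ∀ i, f (g i) = f i),
      ∑ y ∈ (Finset.univ.filter fun y : ι → X =>
        ∀ i, ConjClasses.mk (y (g i)) = ConjClasses.mk (y i)) with
        (fun i => ConjClasses.mk (y i)) = f, ∏ i, wt (y i) = Fintype.card X ^ Fintype.card ι := by
    intro f hf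
    simp only [Finset.mem_filter, Finset.mem_univ, true_and] at hf
    have h1 : ((Finset.univ.filter fun y : ι → X =>
        ∀ i, ConjClasses.mk (y (g i)) = ConjClasses.mk (y i)).filter
        fun y => (fun i => ConjClasses.mk (y i)) = f) =
        Fintype.piFinset fun i => Finset.univ.filter (fun a : X => ConjClasses.mk a = f i) := by
      ext y
      simp only [Finset.mem_filter, Finset.mem_univ, true_and, Fintype.mem_piFinset]
      constructor
      · rintro ⟨_, rfl⟩ i; rfl
      · intro h
        exact ⟨fun i => by rw [h, h, hf], funext h⟩
    rw [h1, ← Finset.prod_univ_sum (fun i => Finset.univ.filter (fun a : X => ConjClasses.mk a = f i))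
      (fun _ a => wt a)]
    simp only [sum_wt]
    simp
  rw [Finset.sum_congr rfl hin, Finset.sum_const, smul_eq_mul, mul_comm]
  congr 1
  unfold Fct
  rw [Nat.card_eq_fintype_card, Fintype.card_subtype]

end Counting

section WreathCount

lemma wreath_comm_base {X : Type*} [Group X] {ι : Type*} (H : Subgroup (Perm ι))
    (z w : Wreath X H) (hw : w.right = 1) (h : Commute w z) (i : ι) :
    w.left i * z.left i = z.left i * w.left (z.right.1.symm i) := by
  have h1 := congrArg SemidirectProduct.left h.eq
  rw [SemidirectProduct.mul_left, SemidirectProduct.mul_left, hw] at h1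
  have h2 := congrFun h1 i
  exact h2

open Classical in
lemma wreath_bound {X : Type*} [Group X] [Finite X] {ι : Type*} [Finite ι]
    (H : Subgroup (Perm ι)) [Fintype H] :
    Fintype.card H * kclass (Wreath X H) ≤ ∑ h : H, Fct X h.1 +
      Fintype.card H * ∑ h ∈ (Finset.univ.filter fun h : H => h ≠ 1), Fct X h.1 := by
  have := Fintype.ofFinite X
  have := Fintype.ofFinite ι
  have : Finite (Wreath X H) := Finite.of_equiv _ (SemidirectProduct.equivProd).symm
  have := Fintype.ofFinite (Wreath X H)
  set b := Fintype.card X ^ Fintype.card ι with hb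
  have hbpos : 0 < b := by positivity
  have hcardW : Nat.card (Wreath X H) = b * Fintype.card H := by
    rw [SemidirectProduct.card, Nat.card_eq_fintype_card, Nat.card_eq_fintype_card]
    simp [hb]
  have hcomm := card_comm_eq_card_conjClasses_mul_card (Wreath X H)
  rw [Nat.card_eq_fintype_card, Fintype.card_subtype, hcardW] at hcomm
  set S : Finset (Wreath X H × Wreath X H) := Finset.univ.filter fun p => Commute p.1 p.2 with hS
  -- the fibre of base elements
  set cnt : H → ℕ := fun g => (Finset.univ.filter fun p : (ι → X) × (ι → X) =>
      ∀ i, p.2 i * p.1 i = p.1 i * p.2 (g.1.symm i)).card with hcnt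
  have hcnt' : ∀ g, cnt g = b * Fct X g.1 := fun g => count_pairs g.1
  have hS1 : (S.filter fun p => p.1.right = 1).card ≤ ∑ h : H, cnt h := by
    rw [Finset.card_eq_sum_card_fiberwise (f := fun p => p.2.right) (t := Finset.univ)
      (by simp [Set.MapsTo])]
    refine Finset.sum_le_sum fun h _ => ?_
    refine Finset.card_le_card_of_injOn (fun p => (p.2.left, p.1.left)) ?_ ?_
    · rintro ⟨w, z⟩ hp
      simp only [hS, Finset.coe_filter, Finset.mem_filter, Finset.mem_univ, true_and,
        Set.mem_ofPred_eq] at hp ⊢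
      obtain ⟨⟨hc, hr⟩, rfl⟩ := hp
      exact fun i => wreath_comm_base H z w hr hc i
    · rintro ⟨w, z⟩ hp ⟨w', z'⟩ hp' he
      simp only [hS, Finset.coe_filter, Finset.mem_filter, Finset.mem_univ, true_and,
        Set.mem_ofPred_eq, Prod.mk.injEq] at hp hp' he ⊢
      exact ⟨SemidirectProduct.ext he.2 (hp.1.2.trans hp'.1.2.symm),
        SemidirectProduct.ext he.1 (hp.2.trans hp'.2.symm)⟩
  have hfib : ∀ g h : H, (S.filter fun p => p.1.right = g ∧ p.2.right = h).card ≤ cnt g := by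
    intro g h
    rw [Finset.card_eq_sum_card_fiberwise (f := fun p => p.1.left) (t := Finset.univ)
      (by simp [Set.MapsTo])]
    simp only [hcnt]
    rw [Finset.card_eq_sum_card_fiberwise (f := fun p : (ι → X) × (ι → X) => p.1)
      (t := Finset.univ) (by simp [Set.MapsTo])]
    refine Finset.sum_le_sum fun x _ => ?_
    rcases Finset.eq_empty_or_nonempty
      ((S.filter fun p => p.1.right = g ∧ p.2.right = h).filter fun p => p.1.left = x) with he | hne
    · rw [he]; simp
    obtain ⟨⟨z0, w0⟩, h0⟩ := hne
    simp only [hS, Finset.mem_filter, Finset.mem_univ, true_and] at h0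
    obtain ⟨⟨hc0, hg0, hh0⟩, hx0⟩ := h0
    refine Finset.card_le_card_of_injOn (fun p => (x, (p.2 * w0⁻¹).left)) ?_ ?_
    · rintro ⟨z, w⟩ hp
      simp only [hS, Finset.coe_filter, Finset.mem_filter, Finset.mem_univ, true_and,
        Set.mem_ofPred_eq] at hp ⊢
      obtain ⟨⟨hc, hg, hh⟩, hx⟩ := hp
      have hz : z = z0 := SemidirectProduct.ext (hx.trans hx0.symm) (hg.trans hg0.symm)
      subst hz
      refine ⟨fun i => ?_, trivial⟩
      have hr : (w * w0⁻¹).right = 1 := by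
        rw [SemidirectProduct.mul_right, SemidirectProduct.inv_right, hh, hh0, mul_inv_cancel]
      have := wreath_comm_base H z (w * w0⁻¹) hr (hc.mul_right hc0.inv_right).symm i
      rw [hx, hg] at this
      exact this
    · rintro ⟨z, w⟩ hp ⟨z', w'⟩ hp' he
      simp only [hS, Finset.coe_filter, Finset.mem_filter, Finset.mem_univ, true_and,
        Set.mem_ofPred_eq, Prod.mk.injEq] at hp hp' he ⊢
      refine ⟨SemidirectProduct.ext (hp.2.trans hp'.2.symm) (hp.1.2.1.trans hp'.1.2.1.symm), ?_⟩
      have h3 : w * w0⁻¹ = w' * w0⁻¹ := by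
        refine SemidirectProduct.ext he ?_
        rw [SemidirectProduct.mul_right, SemidirectProduct.mul_right, hp.1.2.2, hp'.1.2.2]
      exact mul_right_cancel h3
  have hS2 : (S.filter fun p => ¬ p.1.right = 1).card ≤
      ∑ g ∈ (Finset.univ.filter fun h : H => h ≠ 1), Fintype.card H * cnt g := by
    rw [Finset.card_eq_sum_card_fiberwise (f := fun p => p.1.right)
      (t := Finset.univ.filter fun h : H => h ≠ 1) (by intro p; simp)]
    refine Finset.sum_le_sum fun g _ => ?_
    rw [Finset.card_eq_sum_card_fiberwise (f := fun p => p.2.right)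
      (t := Finset.univ) (by simp [Set.MapsTo])]
    have : ∀ h ∈ (Finset.univ : Finset H), (((S.filter fun p => ¬ p.1.right = 1).filter
        fun p => p.1.right = g).filter fun p => p.2.right = h).card ≤ cnt g := by
      intro h _
      refine le_trans (Finset.card_le_card ?_) (hfib g h)
      intro p
      simp only [Finset.mem_filter]
      tauto
    refine (Finset.sum_le_sum this).trans ?_
    simp
  have htot := Finset.card_filter_add_card_filter_not (s := S) (fun p => p.1.right = 1)
  rw [hcomm] at htot
  have hk : Nat.card (ConjClasses (Wreath X H)) = kclass (Wreath X H) := rfl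
  rw [hk] at htot
  have hfin : b * (Fintype.card H * kclass (Wreath X H)) ≤ b * (∑ h : H, Fct X h.1 +
      Fintype.card H * ∑ h ∈ (Finset.univ.filter fun h : H => h ≠ 1), Fct X h.1) := by
    calc b * (Fintype.card H * kclass (Wreath X H))
        = kclass (Wreath X H) * (b * Fintype.card H) := by ring
      _ ≤ ∑ h : H, cnt h + ∑ g ∈ (Finset.univ.filter fun h : H => h ≠ 1), Fintype.card H * cnt g := by
          rw [← htot]; exact Nat.add_le_add hS1 hS2
      _ = _ := by
          simp only [hcnt', ← Finset.mul_sum]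
          ring
  have hfin' := Nat.le_of_mul_le_mul_left hfin hbpos
  convert hfin'

end WreathCount

section Cycles

open Classical in
lemma orbits_bound {ι : Type*} [Fintype ι] (g : Perm ι) :
    2 * Nat.card (Quotient (Perm.SameCycle.setoid g)) +
      (Finset.univ.filter fun i => g i ≠ i).card ≤ 2 * Fintype.card ι := by
  rw [Nat.card_eq_fintype_card]
  have hfix := Finset.card_filter_add_card_filter_not (s := (Finset.univ : Finset ι)) (fun i => g i ≠ i)
  rw [Finset.card_univ] at hfix
  suffices h : 2 * Fintype.card (Quotient (Perm.SameCycle.setoid g)) ≤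
      Fintype.card ι + (Finset.univ.filter fun i => ¬ g i ≠ i).card by omega
  let π : ι → Quotient (Perm.SameCycle.setoid g) := Quotient.mk _
  rw [← Finset.card_univ (α := ι),
    Finset.card_eq_sum_card_fiberwise (s := Finset.univ) (f := π) (t := Finset.univ) (by simp [Set.MapsTo]),
    Finset.card_eq_sum_card_fiberwise (s := Finset.univ.filter fun i => ¬ g i ≠ i) (f := π)
      (t := Finset.univ) (by simp [Set.MapsTo]), ← Finset.sum_add_distrib,
    ← Finset.card_univ, mul_comm, ← smul_eq_mul]
  refine Finset.card_nsmul_le_sum _ _ _ fun q _ => ?_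
  obtain ⟨i, rfl⟩ := Quotient.exists_rep q
  by_cases hi : g i = i
  · have h1 : 0 < (Finset.univ.filter fun j => π j = Quotient.mk _ i).card :=
      Finset.card_pos.2 ⟨i, by simp [π]⟩
    have h2 : 0 < ((Finset.univ.filter fun j => ¬ g j ≠ j).filter
        fun j => π j = Quotient.mk _ i).card :=
      Finset.card_pos.2 ⟨i, by simp [π, hi]⟩
    omega
  · have h1 : 1 < (Finset.univ.filter fun j => π j = Quotient.mk _ i).card := by
      rw [Finset.one_lt_card]
      refine ⟨i, by simp [π], g i, ?_, fun h => hi h.symm⟩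
      simp only [Finset.mem_filter, Finset.mem_univ, true_and, π]
      apply Quotient.sound
      change Perm.SameCycle g (g i) i
      simp only [Perm.sameCycle_apply_left]
      exact Perm.SameCycle.refl _ _
    omega

lemma Fct_le {X : Type*} [Group X] [Finite X] {ι : Type*} [Finite ι] (g : Perm ι) :
    Fct X g ≤ kclass X ^ Nat.card (Quotient (Perm.SameCycle.setoid g)) := by
  unfold Fct kclass
  rw [← Nat.card_fun]
  refine Nat.card_le_card_of_injective (fun f q => f.1 (Quotient.out q)) ?_
  rintro ⟨f, hf⟩ ⟨f', hf'⟩ h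
  have key : ∀ f : ι → ConjClasses X, (∀ i, f (g i) = f i) → ∀ i j, Perm.SameCycle g i j →
      f i = f j := by
    intro f hf i j hij
    obtain ⟨n, rfl⟩ := hij.exists_nat_pow_eq
    induction n with
    | zero => simp
    | succ n ih => 
      rw [pow_succ', Perm.mul_apply, hf]
      exact ih ⟨n, by simp⟩
  ext i
  have h1 : Perm.SameCycle g (Quotient.out (Quotient.mk (Perm.SameCycle.setoid g) i)) i :=
    Quotient.exact (Quotient.out_eq (Quotient.mk (Perm.SameCycle.setoid g) i))
  have := congrFun h (Quotient.mk _ i)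
  simp only at this ⊢
  rw [← key f hf _ _ h1, ← key f' hf' _ _ h1, this]

end Cycles

section Subsets

lemma card_Omega (m ℓ : ℕ) : Fintype.card (Omega m ℓ) = m.choose ℓ := by
  have := Fintype.card_finset_len (α := Fin m) ℓ
  rwa [Fintype.card_fin] at this

lemma count_ins (m ℓ : ℕ) (hℓ : 1 ≤ ℓ) (x : Fin m) (S : Finset (Fin m)) (hx : x ∉ S)
    (P : Omega m ℓ → Prop) [DecidablePred P] (hP : ∀ A : Omega m ℓ, x ∈ A.1 → A.1 ⊆ insert x S → P A) :
    S.card.choose (ℓ - 1) ≤ (Finset.univ.filter P).card := by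
  rw [← Finset.card_powersetCard]
  have hc : ∀ B ∈ Finset.powersetCard (ℓ - 1) S, (insert x B).card = ℓ := by
    intro B hB
    rw [Finset.mem_powersetCard] at hB
    rw [Finset.card_insert_of_notMem (fun h => hx (hB.1 h)), hB.2]
    omega
  rw [← Finset.card_attach]
  refine Finset.card_le_card_of_injOn (fun B => (⟨insert x B.1, hc B.1 B.2⟩ : Omega m ℓ)) ?_ ?_
  · rintro ⟨B, hB⟩ _
    have h1 := (Finset.mem_powersetCard.1 hB).1
    simp only [Finset.coe_filter, Finset.mem_univ, true_and, Set.mem_ofPred_eq]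
    exact hP _ (Finset.mem_insert_self _ _) (Finset.insert_subset_insert _ h1)
  · rintro ⟨B, hB⟩ _ ⟨B', hB'⟩ _ he
    have h1 := (Finset.mem_powersetCard.1 hB).1
    have h2 := (Finset.mem_powersetCard.1 hB').1
    simp only [Subtype.mk.injEq] at he ⊢
    rw [← Finset.erase_insert (fun h => hx (h1 h)), he, Finset.erase_insert (fun h => hx (h2 h))]

lemma count_in (m ℓ : ℕ) (hℓ : 1 ≤ ℓ) (x : Fin m) :
    (m - 1).choose (ℓ - 1) ≤ (Finset.univ.filter fun A : Omega m ℓ => x ∈ A.1).card := by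
  have := count_ins m ℓ hℓ x (Finset.univ.erase x) (by simp) (fun A => x ∈ A.1) (fun A h _ => h)
  simpa using this

lemma count_inout (m ℓ : ℕ) (hℓ : 1 ≤ ℓ) (x y : Fin m) (hxy : x ≠ y) :
    (m - 2).choose (ℓ - 1) ≤
      (Finset.univ.filter fun A : Omega m ℓ => x ∈ A.1 ∧ y ∉ A.1).card := by
  have := count_ins m ℓ hℓ x ((Finset.univ.erase x).erase y) (by simp)
    (fun A => x ∈ A.1 ∧ y ∉ A.1) (fun A h h' => ⟨h, fun hy => by
      have := h' hy
      simp [hxy.symm] at this⟩)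
  rw [Finset.card_erase_of_mem (by simp [hxy.symm]), Finset.card_erase_of_mem (by simp)] at this
  simpa [Nat.sub_sub] using this

lemma count_out (m ℓ : ℕ) (y : Fin m) :
    (m - 1).choose ℓ ≤ (Finset.univ.filter fun A : Omega m ℓ => y ∉ A.1).card := by
  have h1 : ((Finset.univ : Finset (Fin m)).erase y).card = m - 1 := by simp
  rw [← h1, ← Finset.card_powersetCard, ← Finset.card_attach]
  refine Finset.card_le_card_of_injOn
    (fun B => (⟨B.1, (Finset.mem_powersetCard.1 B.2).2⟩ : Omega m ℓ)) ?_ ?_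
  · rintro ⟨B, hB⟩ _
    have h1 := (Finset.mem_powersetCard.1 hB).1
    simp only [Finset.coe_filter, Finset.mem_univ, true_and, Set.mem_ofPred_eq]
    intro hy
    have := h1 hy
    simp at this
  · rintro ⟨B, hB⟩ _ ⟨B', hB'⟩ _ he
    simpa using he

lemma arith_inout (m ℓ : ℕ) (hℓ : 1 ≤ ℓ) (hm : 2 * ℓ < m) :
    ℓ * m.choose ℓ ≤ 2 * m * (m - 2).choose (ℓ - 1) := by
  obtain ⟨l, rfl⟩ : ∃ l, ℓ = l + 1 := ⟨ℓ - 1, by omega⟩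
  obtain ⟨M, rfl⟩ : ∃ M, m = M + 2 := ⟨m - 2, by omega⟩
  have h1 := Nat.add_one_mul_choose_eq (M + 1) l
  have h2 : (M + 1).choose l ≤ 2 * M.choose l := by
    rcases l with _ | l
    · simp
    · rw [Nat.choose_succ_succ']
      have := @Nat.choose_le_succ_of_lt_half_left l M (by omega)
      omega
  simp only [Nat.add_sub_cancel]
  calc (l + 1) * (M + 2).choose (l + 1) = (M + 2) * (M + 1).choose l := by
        rw [mul_comm, ← h1]
    _ ≤ (M + 2) * (2 * M.choose l) := Nat.mul_le_mul_left _ h2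
    _ = _ := by ring

lemma arith_in_out (m ℓ : ℕ) (hℓ : 1 ≤ ℓ) (hm : 2 * ℓ < m) :
    ℓ * (m.choose ℓ * m.choose ℓ) ≤ 2 * m * ((m - 1).choose (ℓ - 1) * (m - 1).choose ℓ) := by
  obtain ⟨l, rfl⟩ : ∃ l, ℓ = l + 1 := ⟨ℓ - 1, by omega⟩
  obtain ⟨M, rfl⟩ : ∃ M, m = M + 1 := ⟨m - 1, by omega⟩
  have h1 := Nat.add_one_mul_choose_eq M l
  have h2 : (M + 1).choose (l + 1) ≤ 2 * M.choose (l + 1) := by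
    rw [Nat.choose_succ_succ']
    have := @Nat.choose_le_succ_of_lt_half_left l M (by omega)
    omega
  simp only [Nat.add_sub_cancel]
  calc (l + 1) * ((M + 1).choose (l + 1) * (M + 1).choose (l + 1))
      = ((M + 1).choose (l + 1) * (l + 1)) * (M + 1).choose (l + 1) := by ring
    _ = ((M + 1) * M.choose l) * (M + 1).choose (l + 1) := by rw [← h1]
    _ ≤ ((M + 1) * M.choose l) * (2 * M.choose (l + 1)) := Nat.mul_le_mul_left _ h2
    _ = _ := by ring

lemma count_pt (t m ℓ : ℕ) (hℓ : 1 ≤ ℓ) (hm : 2 * ℓ < m) (p p' : Fin t × Fin m) (hp : p' ≠ p) :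
    ℓ * (m.choose ℓ) ^ t ≤ 2 * m * (Finset.univ.filter fun ω : Fin t → Omega m ℓ =>
      p.2 ∈ (ω p.1).1 ∧ p'.2 ∉ (ω p'.1).1).card := by
  classical
  obtain ⟨j, x⟩ := p
  obtain ⟨j', y⟩ := p'
  set N := m.choose ℓ with hN
  have hset : (Finset.univ.filter fun ω : Fin t → Omega m ℓ =>
      x ∈ (ω j).1 ∧ y ∉ (ω j').1) = Fintype.piFinset fun i =>
        Finset.univ.filter fun A : Omega m ℓ => (i = j → x ∈ A.1) ∧ (i = j' → y ∉ A.1) := by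
    ext ω
    simp only [Finset.mem_filter, Finset.mem_univ, true_and, Fintype.mem_piFinset]
    constructor
    · rintro ⟨h1, h2⟩ i
      exact ⟨by rintro rfl; exact h1, by rintro rfl; exact h2⟩
    · intro h
      exact ⟨(h j).1 rfl, (h j').2 rfl⟩
  simp only
  rw [hset, Fintype.card_piFinset]
  have hother : ∀ i, i ≠ j → i ≠ j' → (Finset.univ.filter fun A : Omega m ℓ =>
      (i = j → x ∈ A.1) ∧ (i = j' → y ∉ A.1)).card = N := by
    intro i h1 h2
    simp [h1, h2, hN]
  have hcard : ∀ s : Finset (Fin t), s ⊆ Finset.univ → (∀ i ∈ s, i ≠ j ∧ i ≠ j') →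
      ∏ i ∈ s, (Finset.univ.filter fun A : Omega m ℓ =>
      (i = j → x ∈ A.1) ∧ (i = j' → y ∉ A.1)).card = N ^ s.card := by
    intro s _ hs
    rw [← Finset.prod_const]
    exact Finset.prod_congr rfl fun i hi => hother i (hs i hi).1 (hs i hi).2
  by_cases hj : j = j'
  · subst hj
    have hxy : x ≠ y := by rintro rfl; exact hp rfl
    rw [← Finset.mul_prod_erase _ _ (Finset.mem_univ j), hcard _ (by simp) (by simp)]
    have h1 := count_inout m ℓ hℓ x y hxy
    have h2 := arith_inout m ℓ hℓ hm
    have h3 : (Finset.univ.erase j).card + 1 = t := by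
      rw [Finset.card_erase_add_one (Finset.mem_univ j)]; simp
    conv_lhs => rw [← h3]
    simp only [forall_const]
    rw [pow_succ]
    calc ℓ * (N ^ (Finset.univ.erase j).card * N) = (ℓ * N) * N ^ (Finset.univ.erase j).card := by ring
      _ ≤ (2 * m * (Finset.univ.filter fun A : Omega m ℓ => x ∈ A.1 ∧ y ∉ A.1).card) *
          N ^ (Finset.univ.erase j).card :=
          Nat.mul_le_mul_right _ (h2.trans (Nat.mul_le_mul_left _ h1))
      _ = _ := by ring
  · rw [← Finset.mul_prod_erase _ _ (Finset.mem_univ j),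
      ← Finset.mul_prod_erase (Finset.univ.erase j) _ (a := j') (by simp [Ne.symm hj]),
      hcard _ (by simp) (by simp; tauto)]
    have h1 := count_in m ℓ hℓ x
    have h1' := count_out m ℓ y
    have h2 := arith_in_out m ℓ hℓ hm
    have h3 : ((Finset.univ.erase j).erase j').card + 1 + 1 = t := by
      rw [Finset.card_erase_add_one (by simp [Ne.symm hj]),
        Finset.card_erase_add_one (Finset.mem_univ j)]; simp
    set c := ((Finset.univ.erase j).erase j').card
    conv_lhs => rw [← h3]
    simp only [hj, Ne.symm hj, forall_const, false_implies, true_and, and_true]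
    rw [pow_succ, pow_succ]
    calc ℓ * (N ^ c * N * N) = (ℓ * (N * N)) * N ^ c := by ring
      _ ≤ (2 * m * ((Finset.univ.filter fun A : Omega m ℓ => x ∈ A.1).card *
            (Finset.univ.filter fun A : Omega m ℓ => y ∉ A.1).card)) * N ^ c :=
          Nat.mul_le_mul_right _ (h2.trans (Nat.mul_le_mul_left _ (Nat.mul_le_mul h1 h1')))
      _ = _ := by ring

end Subsets

section Moved

/-- the explicit form of elements of the full wreath product in product action -/
def IsForm {t m ℓ : ℕ} (h : Perm (Fin t → Omega m ℓ)) (a : Fin t → Perm (Fin m))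
    (π : Perm (Fin t)) : Prop :=
  ∀ ω i, h ω i = a i • ω (π.symm i)

/-- the imprimitive action map attached to a form -/
def formMap {t m : ℕ} (a : Fin t → Perm (Fin m)) (π : Perm (Fin t)) :
    Fin t × Fin m → Fin t × Fin m := fun p => (π p.1, a (π p.1) p.2)

lemma exists_form {t m ℓ : ℕ} (h : Perm (Fin t → Omega m ℓ)) (hh : h ∈ largeBaseTop m ℓ t) :
    ∃ a π, IsForm h a π := by
  let K : Subgroup (Perm (Fin t → Omega m ℓ)) :=
    { carrier := {h | ∃ a π, IsForm h a π}
      one_mem' := ⟨1, 1, fun ω i => by simp only [Pi.one_apply, one_smul]; rfl⟩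
      mul_mem' := by
        rintro g h ⟨a, π, hg⟩ ⟨b, ρ, hh⟩
        refine ⟨fun i => a i * b (π.symm i), π * ρ, fun ω i => ?_⟩
        rw [Perm.mul_apply, hg, hh, mul_smul]
        rfl
      inv_mem' := by
        rintro g ⟨a, π, hg⟩
        refine ⟨fun i => (a (π i))⁻¹, π⁻¹, fun ω i => ?_⟩
        have h1 := hg (g⁻¹ ω) (π i)
        have h0 : g (g⁻¹ ω) = ω := g.apply_symm_apply ω
        rw [h0] at h1
        rw [eq_inv_smul_iff]
        simp only [Equiv.symm_apply_apply] at h1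
        rw [← h1]
        rfl }
  have hle : largeBaseTop m ℓ t ≤ K := by
    unfold largeBaseTop
    refine sup_le ?_ ?_
    · rintro _ ⟨c, hc, rfl⟩
      have hc' : ∀ i, ∃ b, subsetsHom m ℓ b = c i := fun i => hc i trivial
      choose b hb using hc'
      refine ⟨b, 1, fun ω i => ?_⟩
      change c i (ω i) = _
      rw [← hb]
      rfl
    · rintro _ ⟨π, rfl⟩
      refine ⟨1, π, fun ω i => ?_⟩
      simp only [Pi.one_apply, one_smul]
      rfl
  exact hle hh

lemma form_inj {t m ℓ : ℕ} (hm : 0 < m) {h h' : Perm (Fin t → Omega m ℓ)} {a a' π π'}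
    (hf : IsForm h a π) (hf' : IsForm h' a' π') (he : formMap a π = formMap a' π') : h = h' := by
  have h1 : π = π' := by
    ext j
    have := congrFun he (j, ⟨0, hm⟩)
    simp only [formMap, Prod.mk.injEq] at this
    rw [this.1]
  subst h1
  have h2 : a = a' := by
    funext i
    ext x
    have := congrFun he (π.symm i, x)
    simp only [formMap, Prod.mk.injEq, Equiv.apply_symm_apply] at this
    rw [this.2]
  subst h2
  ext1 ω
  funext i
  rw [hf, hf']

open Classical in
lemma moved_bound {t m ℓ : ℕ} (hℓ : 1 ≤ ℓ) (hm : 2 * ℓ < m) {h : Perm (Fin t → Omega m ℓ)} {a π}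
    (hf : IsForm h a π) :
    (Finset.univ.filter fun p => formMap a π p ≠ p).card * (m.choose ℓ) ^ t ≤
      2 * (t * m) * (Finset.univ.filter fun ω => h ω ≠ ω).card := by
  set s := (Finset.univ.filter fun p => formMap a π p ≠ p) with hs
  set u := (Finset.univ.filter fun ω => h ω ≠ ω) with hu
  let r : Fin t × Fin m → (Fin t → Omega m ℓ) → Prop := fun p ω =>
    p.2 ∈ (ω p.1).1 ∧ (formMap a π p).2 ∉ (ω (formMap a π p).1).1
  have hdc := Finset.sum_card_bipartiteAbove_eq_sum_card_bipartiteBelow r (s := s) (t := u)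
  have habove : ∀ p ∈ s, ℓ * (m.choose ℓ) ^ t ≤ 2 * m * (Finset.bipartiteAbove r u p).card := by
    intro p hp
    rw [hs, Finset.mem_filter] at hp
    refine (count_pt t m ℓ hℓ hm p (formMap a π p) hp.2).trans ?_
    refine Nat.mul_le_mul_left _ (Finset.card_le_card ?_)
    intro ω hω
    simp only [Finset.mem_filter, Finset.mem_univ, true_and] at hω
    simp only [Finset.mem_bipartiteAbove, hu, Finset.mem_filter, Finset.mem_univ, true_and]
    refine ⟨fun heq => ?_, hω⟩
    apply hω.2
    have h1 := hf ω (π p.1)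
    rw [heq, Equiv.symm_apply_apply] at h1
    simp only [formMap]
    rw [h1]
    change a (π p.1) p.2 ∈ (ω p.1).1.image (a (π p.1))
    exact Finset.mem_image_of_mem _ hω.1
  have hbelow : ∀ ω ∈ u, (Finset.bipartiteBelow r s ω).card ≤ t * ℓ := by
    intro ω _
    have h1 : Finset.bipartiteBelow r s ω ⊆ (Finset.univ : Finset (Fin t)).biUnion
        fun i => (ω i).1.image fun x => (i, x) := by
      intro p hp
      rw [Finset.mem_bipartiteBelow] at hp
      simp only [Finset.mem_biUnion, Finset.mem_univ, true_and, Finset.mem_image]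
      exact ⟨p.1, p.2, hp.2.1, rfl⟩
    refine (Finset.card_le_card h1).trans ?_
    refine (Finset.card_biUnion_le_card_mul _ _ ℓ ?_).trans (by simp)
    intro i _
    exact Finset.card_image_le.trans (ω i).2.le
  have h1 : s.card * (ℓ * (m.choose ℓ) ^ t) ≤ 2 * m * ∑ p ∈ s, (Finset.bipartiteAbove r u p).card := by
    rw [Finset.mul_sum, ← smul_eq_mul]
    exact Finset.card_nsmul_le_sum _ _ _ habove
  have h2 : ∑ ω ∈ u, (Finset.bipartiteBelow r s ω).card ≤ u.card * (t * ℓ) := by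
    rw [← smul_eq_mul]
    exact Finset.sum_le_card_nsmul _ _ _ hbelow
  rw [hdc] at h1
  have h3 := h1.trans (Nat.mul_le_mul_left _ h2)
  refine le_of_mul_le_mul_left ?_ hℓ
  calc ℓ * (s.card * (m.choose ℓ) ^ t) = s.card * (ℓ * (m.choose ℓ) ^ t) := by ring
    _ ≤ _ := h3
    _ = _ := by ring

end Moved

section Final

lemma sum_maps {P : Type*} [Fintype P] [DecidableEq P] (q : ℝ) (hq : 0 ≤ q) :
    ∑ T : P → P, q ^ (Finset.univ.filter fun p => T p ≠ p).card ≤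
      (1 + Fintype.card P * q) ^ Fintype.card P := by
  have h1 : ∀ T : P → P, q ^ (Finset.univ.filter fun p => T p ≠ p).card =
      ∏ p, (if T p ≠ p then q else 1) := by
    intro T
    rw [Finset.prod_ite]
    simp
  simp only [h1]
  have h2 := Finset.prod_univ_sum (fun _ : P => (Finset.univ : Finset P))
    (fun p x => if x ≠ p then q else (1 : ℝ))
  rw [Fintype.piFinset_univ] at h2
  rw [← h2]
  have h3 : ∀ p ∈ (Finset.univ : Finset P), ∑ x : P, (if x ≠ p then q else (1 : ℝ)) ≤
      1 + Fintype.card P * q := by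
    intro p _
    calc ∑ x : P, (if x ≠ p then q else (1 : ℝ)) ≤ ∑ x : P, ((if x = p then 1 else 0) + q) := by
          refine Finset.sum_le_sum fun x _ => ?_
          by_cases h : x = p <;> simp [h, hq]
      _ = _ := by
          rw [Finset.sum_add_distrib]
          simp
  refine (Finset.prod_le_prod (fun p _ => Finset.sum_nonneg fun x _ => ?_) h3).trans ?_
  · split_ifs <;> simp [hq]
  · simp

lemma choose_mono_half (m a b : ℕ) (hab : a ≤ b) (hb : 2 * b ≤ m) : m.choose a ≤ m.choose b := by
  induction b, hab using Nat.le_induction with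
  | base => exact le_rfl
  | succ b hab ih => 
    exact (ih (by omega)).trans (Nat.choose_le_succ_of_lt_half_left (by omega))

lemma deg_bound (t m ℓ : ℕ) (ht : 1 ≤ t) (hm : 5 ≤ m) (hℓ : 1 ≤ ℓ) (hℓm : 2 * ℓ < m)
    (hne : (t, ℓ) ≠ (1, 1)) : (t * m) ^ 2 ≤ 4 * (m.choose ℓ) ^ t := by
  rcases Nat.lt_or_ge t 2 with h | h
  · obtain rfl : t = 1 := by omega
    have hl2 : 2 ≤ ℓ := by
      rcases Nat.lt_or_ge ℓ 2 with h' | h'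
      · exact absurd (by rw [show ℓ = 1 by omega]) hne
      · exact h'
    have h1 := choose_mono_half m 2 ℓ hl2 (by omega)
    rw [pow_one, one_mul]
    refine le_trans ?_ (Nat.mul_le_mul_left 4 h1)
    obtain ⟨M, rfl⟩ : ∃ M, m = M + 1 := ⟨m - 1, by omega⟩
    have h2 := Nat.add_one_mul_choose_eq M 1
    rw [Nat.choose_one_right] at h2
    norm_num at h2
    nlinarith
  · have h1 : m ≤ m.choose ℓ := by
      have := choose_mono_half m 1 ℓ hℓ (by omega)
      rwa [Nat.choose_one_right] at this
    refine le_trans ?_ (Nat.mul_le_mul_left 4 (Nat.pow_le_pow_left h1 t))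
    obtain ⟨u, rfl⟩ : ∃ u, t = u + 2 := ⟨t - 2, by omega⟩
    have h2 : (u + 2) ^ 2 ≤ 4 * m ^ u := by
      clear h hne ht
      induction u with
      | zero => norm_num
      | succ u ih => 
        rw [pow_succ m u]
        have h3 : m ^ u * 5 ≤ m ^ u * m := Nat.mul_le_mul_left _ hm
        have h4 : (u + 1 + 2) ^ 2 ≤ 5 * (u + 2) ^ 2 := by
          ring_nf
          have := Nat.zero_le (u ^ 2)
          omega
        linarith
    rw [mul_pow, pow_add]
    nlinarith [Nat.zero_le (m ^ 2)]

lemma two_le_kclass (X : Type*) [Group X] [Finite X] [Nontrivial X] : 2 ≤ kclass X := by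
  unfold kclass
  obtain ⟨x, hx⟩ := exists_ne (1 : X)
  have : Nontrivial (ConjClasses X) := by
    refine ⟨ConjClasses.mk 1, ConjClasses.mk x, fun h => hx ?_⟩
    rw [ConjClasses.mk_eq_mk_iff_isConj] at h
    exact isConj_one_right.1 h
  exact Finite.one_lt_card

lemma exists_large_const : ∃ C : ℕ, ∀ n k : ℕ, 1 ≤ n → 2 ≤ k → (C ≤ n ∨ C ≤ k) →
    20 * (n : ℝ) ≤ (k : ℝ) ^ (Real.sqrt n / 8) := by
  have h1 : ∀ᶠ n : ℕ in Filter.atTop, 20 * (n : ℝ) ≤ (2 : ℝ) ^ (Real.sqrt n / 8) := by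
    have hl : (fun x : ℝ => x ^ (2 : ℝ)) =o[Filter.atTop] fun x => Real.exp ((Real.log 2 / 8) * x) :=
      isLittleO_rpow_exp_pos_mul_atTop 2 (by positivity)
    have h2 := hl.bound (show (0 : ℝ) < 1 / 20 by norm_num)
    have htend : Filter.Tendsto (fun n : ℕ => Real.sqrt n) Filter.atTop Filter.atTop :=
      Real.tendsto_sqrt_atTop.comp tendsto_natCast_atTop_atTop
    filter_upwards [htend.eventually h2] with n hn
    rw [Real.rpow_two, Real.sq_sqrt (Nat.cast_nonneg n), Real.norm_eq_abs, Real.norm_eq_abs,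
      abs_of_nonneg (Nat.cast_nonneg n), abs_of_pos (Real.exp_pos _)] at hn
    rw [Real.rpow_def_of_pos (by norm_num)]
    have : Real.log 2 * (Real.sqrt n / 8) = Real.log 2 / 8 * Real.sqrt n := by ring
    rw [this]
    linarith
  obtain ⟨C0, hC0⟩ := Filter.eventually_atTop.1 h1
  refine ⟨max C0 ((20 * C0) ^ 8), fun n k hn hk h => ?_⟩
  have hk2 : (2 : ℝ) ≤ k := by exact_mod_cast hk
  have hmain : C0 ≤ n → 20 * (n : ℝ) ≤ (k : ℝ) ^ (Real.sqrt n / 8) := fun h =>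
    (hC0 n h).trans (Real.rpow_le_rpow (by norm_num) hk2 (by positivity))
  rcases h with h | h
  · exact hmain ((le_max_left _ _).trans h)
  · by_cases hn0 : C0 ≤ n
    · exact hmain hn0
    · have h3 : (20 * C0) ^ 8 ≤ k := (le_max_right _ _).trans h
      have h4 : ((20 * C0 : ℝ)) ^ 8 ≤ k := by exact_mod_cast h3
      have h5 : (1 : ℝ) ≤ Real.sqrt n := by
        rw [Real.one_le_sqrt]; exact_mod_cast hn
      have h6 : (20 * C0 : ℝ) ≤ (k : ℝ) ^ ((1 : ℝ) / 8) := by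
        have := Real.rpow_le_rpow (by positivity) h4 (show (0 : ℝ) ≤ 1 / 8 by norm_num)
        rw [← Real.rpow_natCast, ← Real.rpow_mul (by positivity)] at this
        norm_num at this ⊢
        exact this
      have h7 : (k : ℝ) ^ ((1 : ℝ) / 8) ≤ (k : ℝ) ^ (Real.sqrt n / 8) :=
        Real.rpow_le_rpow_of_exponent_le (by linarith) (by linarith)
      have h8 : (n : ℝ) ≤ C0 := by exact_mod_cast (not_le.1 hn0).le
      linarith

end Final

/-- For a large base primitive group `H` of degree `n = C(m,ℓ)^t` with `(t,ℓ) ≠ (1,1)`,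
`k(X ≀ H) ≤ k^n` whenever `n` or `k = k(X)` is sufficiently large. -/
theorem statement17 :
    ∃ C : ℕ, ∀ (X : Type) [Group X] [Finite X], Nontrivial X →
      ∀ t m ℓ : ℕ, 1 ≤ t → 5 ≤ m → 1 ≤ ℓ → 2 * ℓ < m → (t, ℓ) ≠ (1, 1) →
      ∀ n : ℕ, n = (m.choose ℓ) ^ t →
      ∀ H : Subgroup (Perm (Fin t → Omega m ℓ)),
        largeBaseBot m ℓ t ≤ H → H ≤ largeBaseTop m ℓ t →
        (IsPretransitive H (Fin t → Omega m ℓ) ∧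
          ∀ B : Set (Fin t → Omega m ℓ), IsBlock H B → B.Subsingleton ∨ B = Set.univ) →
        (C ≤ n ∨ C ≤ kclass X) → kclass (Wreath X H) ≤ kclass X ^ n := by
  classical
  obtain ⟨C, hC⟩ := exists_large_const
  refine ⟨C, ?_⟩
  intro X _ _ hX t m ℓ ht hm hℓ hℓm hne n hn H _ hHtop hprim hlarge
  have hN : 5 ≤ m.choose ℓ := by
    have := choose_mono_half m 1 ℓ hℓ (by omega)
    rw [Nat.choose_one_right] at this
    omega
  have hn5 : 5 ≤ n := by
    rw [hn]
    exact hN.trans (Nat.le_self_pow (by omega) _)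
  have hk : 2 ≤ kclass X := two_le_kclass X
  have hkey := hC n (kclass X) (by omega) hk hlarge
  have : Fintype H := Fintype.ofFinite H
  have hcardΛ : Fintype.card (Fin t → Omega m ℓ) = n := by
    rw [Fintype.card_fun, card_Omega, Fintype.card_fin, hn]
  -- `H` is nontrivial
  have hH2 : 2 ≤ Fintype.card H := by
    by_contra hlt
    have hsub : Subsingleton H := Fintype.card_le_one_iff_subsingleton.1 (by omega)
    have hnt : Nontrivial (Fin t → Omega m ℓ) := Fintype.one_lt_card_iff_nontrivial.1 (by omega)
    obtain ⟨x, y, hxy⟩ := hnt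
    obtain ⟨g, hg⟩ := hprim.1.exists_smul_eq x y
    rw [Subsingleton.elim g 1, one_smul] at hg
    exact hxy hg
  have hdeg := deg_bound t m ℓ ht hm hℓ hℓm hne
  rw [← hn] at hdeg
  have hM : 0 < t * m := Nat.mul_pos (by omega) (by omega)
  set k : ℝ := (kclass X : ℝ) with hkdef
  have hk2 : (2 : ℝ) ≤ k := by rw [hkdef]; exact_mod_cast hk
  have hk0 : (0 : ℝ) < k := by linarith
  have hn0 : (0 : ℝ) < n := by exact_mod_cast (by omega : 0 < n)
  have hsq : Real.sqrt n * Real.sqrt n = n := Real.mul_self_sqrt hn0.le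
  have hsq0 : 0 < Real.sqrt n := Real.sqrt_pos.2 hn0
  set M : ℝ := ((t * m : ℕ) : ℝ) with hMdef
  have hM0 : 0 < M := by rw [hMdef]; exact_mod_cast hM
  have hM2 : M ^ 2 ≤ 4 * n := by rw [hMdef]; exact_mod_cast hdeg
  have hMle : M ≤ 2 * Real.sqrt n := by
    nlinarith
  set q : ℝ := k ^ (-(Real.sqrt n / 8)) with hq
  have hq0 : 0 < q := Real.rpow_pos_of_pos hk0 _
  have hMq : M * (M * q) ≤ 1 / 5 := by
    have h1 : q * (20 * n) ≤ 1 := by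
      calc q * (20 * n) ≤ q * k ^ (Real.sqrt n / 8) := mul_le_mul_of_nonneg_left hkey hq0.le
        _ = 1 := by rw [hq, ← Real.rpow_add hk0]; simp
    nlinarith
  -- the associated maps
  have hform : ∀ h : H, ∃ aπ : (Fin t → Perm (Fin m)) × Perm (Fin t), IsForm h.1 aπ.1 aπ.2 := by
    intro h
    obtain ⟨a, π, h1⟩ := exists_form h.1 (hHtop h.2)
    exact ⟨(a, π), h1⟩
  choose aπ haπ using hform
  let T : H → (Fin t × Fin m → Fin t × Fin m) := fun h => formMap (aπ h).1 (aπ h).2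
  have hTinj : Function.Injective T := fun h h' he =>
    Subtype.ext (form_inj (by omega) (haπ h) (haπ h') he)
  let sp : (Fin t × Fin m → Fin t × Fin m) → ℕ := fun T => (Finset.univ.filter fun p => T p ≠ p).card
  have hmoved : ∀ h : H, sp (T h) * n ≤ 2 * (t * m) *
      (Finset.univ.filter fun ω => h.1 ω ≠ ω).card := by
    intro h
    have := moved_bound hℓ hℓm (haπ h)
    rw [← hn] at this
    convert this
  have hT1 : sp (T 1) = 0 := by
    have := hmoved 1
    simp only [OneMemClass.coe_one, Perm.one_apply, ne_eq, not_true_eq_false,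
      Finset.filter_false, Finset.card_empty, mul_zero, nonpos_iff_eq_zero, mul_eq_zero] at this
    omega
  have hsum : ∑ h : H, q ^ sp (T h) ≤ 5 / 4 := by
    have h1 : ∑ h : H, q ^ sp (T h) ≤ ∑ f : Fin t × Fin m → Fin t × Fin m, q ^ sp f := by
      rw [← Finset.sum_image (s := Finset.univ) (g := T) (f := fun f => q ^ sp f)
        (fun a _ b _ h => hTinj h)]
      exact Finset.sum_le_sum_of_subset_of_nonneg (Finset.subset_univ _)
        (fun _ _ _ => by positivity)
    have h2 := sum_maps (P := Fin t × Fin m) q hq0.le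
    have hcP : Fintype.card (Fin t × Fin m) = t * m := by simp
    rw [hcP] at h2
    have h3 : (1 + M * q) ^ (t * m) ≤ 5 / 4 := by
      have h4 : 1 + M * q ≤ Real.exp (M * q) := by linarith [Real.add_one_le_exp (M * q)]
      calc (1 + M * q) ^ (t * m) ≤ Real.exp (M * q) ^ (t * m) :=
            pow_le_pow_left₀ (by positivity) h4 _
        _ = Real.exp (M * (M * q)) := by rw [← Real.exp_nat_mul]
        _ ≤ Real.exp (1 / 5) := Real.exp_le_exp.2 hMq
        _ ≤ 5 / 4 := by
            have h5 := Real.add_one_le_exp (-(1 / 5) : ℝ)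
            rw [Real.exp_neg] at h5
            have h6 := Real.exp_pos (1 / 5 : ℝ)
            have h7 : Real.exp (1 / 5 : ℝ) * (Real.exp (1 / 5 : ℝ))⁻¹ = 1 := mul_inv_cancel₀ h6.ne'
            nlinarith
    refine h1.trans (le_trans (le_of_eq ?_) (h2.trans h3))
    rfl
  have hF : ∀ h : H, (Fct X h.1 : ℝ) ≤ k ^ n * q ^ sp (T h) := by
    intro h
    have h1 := Fct_le (X := X) h.1
    have h2 := orbits_bound h.1
    have h3 := hmoved h
    rw [hcardΛ] at h2
    set o := Nat.card (Quotient (Perm.SameCycle.setoid h.1)) with ho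
    set mv := (Finset.univ.filter fun ω => h.1 ω ≠ ω).card with hmv
    have h2' : 2 * (o : ℝ) + mv ≤ 2 * n := by
      have h2n : 2 * o + mv ≤ 2 * n := by convert h2
      exact_mod_cast h2n
    have h3' : (sp (T h) : ℝ) * n ≤ 2 * M * mv := by
      rw [hMdef]
      exact_mod_cast h3
    have h4 : (sp (T h) : ℝ) * Real.sqrt n ≤ 4 * mv := by
      have h5 : 2 * M * mv ≤ 2 * (2 * Real.sqrt n) * mv := by gcongr
      have h6 : Real.sqrt n * (sp (T h) * Real.sqrt n) ≤ Real.sqrt n * (4 * mv) := by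
        nlinarith
      exact le_of_mul_le_mul_left h6 hsq0
    calc (Fct X h.1 : ℝ) ≤ ((kclass X ^ o : ℕ) : ℝ) := by exact_mod_cast h1
      _ = k ^ (o : ℝ) := by rw [Real.rpow_natCast]; push_cast; rfl
      _ ≤ k ^ ((n : ℝ) + (-(Real.sqrt n / 8)) * (sp (T h) : ℝ)) := by
          apply Real.rpow_le_rpow_of_exponent_le (by linarith)
          linarith
      _ = _ := by
          rw [Real.rpow_add hk0, Real.rpow_mul hk0.le, Real.rpow_natCast, Real.rpow_natCast]
  have hsum1 : ∑ h ∈ (Finset.univ.filter fun h : H => h ≠ 1), q ^ sp (T h) ≤ 1 / 4 := by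
    have h1 := Finset.sum_erase_add (s := Finset.univ) (f := fun h : H => q ^ sp (T h))
      (a := 1) (Finset.mem_univ _)
    simp only [hT1, pow_zero] at h1
    rw [Finset.filter_ne']
    linarith
  have hw := wreath_bound (X := X) H
  have hw' : (Fintype.card H : ℝ) * (kclass (Wreath X H) : ℝ) ≤ ∑ h : H, (Fct X h.1 : ℝ) +
      Fintype.card H * ∑ h ∈ (Finset.univ.filter fun h : H => h ≠ 1), (Fct X h.1 : ℝ) := by
    have hwN : Fintype.card H * kclass (Wreath X H) ≤ ∑ h : H, Fct X h.1 +
      Fintype.card H * ∑ h ∈ (Finset.univ.filter fun h : H => h ≠ 1), Fct X h.1 := by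
      convert hw
    exact_mod_cast hwN
  have hkn : 0 < k ^ n := by positivity
  have hA : ∑ h : H, (Fct X h.1 : ℝ) ≤ k ^ n * (5 / 4) := by
    refine (Finset.sum_le_sum fun h _ => hF h).trans ?_
    rw [← Finset.mul_sum]
    exact mul_le_mul_of_nonneg_left hsum hkn.le
  have hB : ∑ h ∈ (Finset.univ.filter fun h : H => h ≠ 1), (Fct X h.1 : ℝ) ≤ k ^ n * (1 / 4) := by
    refine (Finset.sum_le_sum fun h _ => hF h).trans ?_
    rw [← Finset.mul_sum]
    exact mul_le_mul_of_nonneg_left hsum1 hkn.le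
  have hH2' : (2 : ℝ) ≤ Fintype.card H := by exact_mod_cast hH2
  have hfin : (Fintype.card H : ℝ) * (kclass (Wreath X H) : ℝ) ≤ Fintype.card H * k ^ n := by
    have hB' := mul_le_mul_of_nonneg_left hB (by linarith : (0 : ℝ) ≤ Fintype.card H)
    nlinarith
  have hres : (kclass (Wreath X H) : ℝ) ≤ k ^ n := le_of_mul_le_mul_left hfin (by linarith)
  rw [hkdef] at hres
  exact_mod_cast hres
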